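/- Let ρ be a bipartite state on A⊗B (dimensions dA, dB) with reduced state ρ_B. Then the multiset of nonzero eigenvalues of ρ equals the multiset of nonzero eigenvalues of ρ_B (counted with multiplicity) if and only if there exists a unit vector ψ ∈ ℂ^(dA·dB·dB), indexed by (Fin dA × Fin dB × Fin dB), such that the rank-one matrix ψψᴴ has partial trace over the third factor equal to ρ, and the reduced states of ψψᴴ on the second factor and on the third factor are equal (∑_{a,c} (ψψᴴ) (a,b,c) (a,b',c) = ∑_{a,c} (ψψᴴ) (a,c,b) (a,c,b') for all b,b'). -/

import Mathlib

open Matrix Kronecker ComplexOrder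

noncomputable section

/-- `σ` is a symmetric extension of the bipartite state `ρ`:
`σ` is PSD, has trace 1, its partial trace over the third factor is `ρ`,
and it is invariant under swapping the two `B` factors. -/
def IsSymExt {A B : Type*} [Fintype A] [DecidableEq A] [Fintype B] [DecidableEq B]
    (ρ : Matrix (A × B) (A × B) ℂ)
    (σ : Matrix (A × B × B) (A × B × B) ℂ) : Prop :=
  σ.PosSemidef ∧ σ.trace = 1 ∧
  (∀ a a' b b', ∑ c, σ (a, b, c) (a', b', c) = ρ (a, b) (a', b')) ∧
  (∀ a b₁ b₂ a' b₁' b₂', σ (a, b₁, b₂) (a', b₁', b₂') = σ (a, b₂, b₁) (a', b₂', b₁'))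

/-- The reduced state on the second factor. -/
def reduceB {A B : Type*} [Fintype A] (ρ : Matrix (A × B) (A × B) ℂ) : Matrix B B ℂ :=
  fun b b' => ∑ a, ρ (a, b) (a, b')

/-- The multiset of nonzero eigenvalues (with algebraic multiplicity). -/
def nonzeroSpec {n : Type*} [Fintype n] [DecidableEq n] (M : Matrix n n ℂ) : Multiset ℂ :=
  M.charpoly.roots.filter (· ≠ 0)

/-- The largest (real) eigenvalue of a matrix. -/
def lamMax {n : Type*} [Fintype n] [DecidableEq n] (M : Matrix n n ℂ) : ℝ :=
  sSup {x : ℝ | (x : ℂ) ∈ spectrum ℂ M}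

/-- `ρ` admits a pure (rank-one) symmetric extension. -/
def PureExt {A B : Type*} [Fintype A] [DecidableEq A] [Fintype B] [DecidableEq B]
    (ρ : Matrix (A × B) (A × B) ℂ) : Prop :=
  ∃ σ : Matrix (A × B × B) (A × B × B) ℂ, IsSymExt ρ σ ∧ σ.rank = 1

open Polynomial in
theorem nonzeroSpec_mul_comm {n m : Type*} [Fintype n] [DecidableEq n] [Fintype m]
    [DecidableEq m] (M : Matrix n m ℂ) (N : Matrix m n ℂ) :
    nonzeroSpec (M * N) = nonzeroSpec (N * M) := by
  have h := congrArg (fun p : ℂ[X] => p.roots.filter (· ≠ 0)) (charpoly_mul_comm' M N)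
  have key : ∀ (k : ℕ) (p : ℂ[X]), p ≠ 0 →
      (X ^ k * p).roots.filter (· ≠ 0) = p.roots.filter (· ≠ 0) := by
    intro k p hp
    rw [roots_mul (mul_ne_zero (pow_ne_zero _ X_ne_zero) hp), Multiset.filter_add, roots_X_pow,
      Multiset.nsmul_singleton]
    simp [Multiset.filter_eq_nil, Multiset.mem_replicate]
  simp only [key _ _ (charpoly_monic _).ne_zero] at h
  exact h

theorem nonzeroSpec_transpose {n : Type*} [Fintype n] [DecidableEq n] (M : Matrix n n ℂ) :
    nonzeroSpec Mᵀ = nonzeroSpec M := by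
  rw [nonzeroSpec, nonzeroSpec, charpoly_transpose]

theorem card_eigenvalues_eq_count_nonzeroSpec {n : Type*} [Fintype n] [DecidableEq n]
    {M : Matrix n n ℂ} (hM : M.IsHermitian) {c : ℝ} (hc : c ≠ 0) :
    Fintype.card {i // hM.eigenvalues i = c} = (nonzeroSpec M).count (c : ℂ) := by
  rw [nonzeroSpec, Multiset.count_filter_of_pos (by simpa using hc),
    hM.roots_charpoly_eq_eigenvalues, Multiset.count_map, Fintype.card_subtype, Finset.card_def,
    Finset.filter_val]
  congr 2
  ext i
  simp [eq_comm]

/-- A relation matching the nonzero entries of `u` bijectively with equal entries of `v`. -/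
structure NonzeroMatching {n m : Type*} (u : n → ℝ) (v : m → ℝ) (R : n → m → Prop) : Prop where
  eq : ∀ {i j}, R i j → u i = v j
  left_unique : ∀ {i i' j}, R i j → R i' j → i = i'
  right_unique : ∀ {i j j'}, R i j → R i j' → j = j'
  left_total : ∀ i, u i ≠ 0 → ∃ j, R i j
  right_total : ∀ j, v j ≠ 0 → ∃ i, R i j

theorem NonzeroMatching.symm {n m : Type*} {u : n → ℝ} {v : m → ℝ} {R : n → m → Prop}
    (h : NonzeroMatching u v R) : NonzeroMatching v u (fun j i => R i j) :=
  ⟨fun r => (h.eq r).symm, h.right_unique, h.left_unique, h.right_total, h.left_total⟩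

theorem exists_nonzeroMatching {n m : Type*} [Fintype n] [Fintype m] (u : n → ℝ) (v : m → ℝ)
    (h : ∀ c : ℝ, c ≠ 0 → Fintype.card {i // u i = c} = Fintype.card {j // v j = c}) :
    ∃ R, NonzeroMatching u v R := by
  have E : ∀ c : ℝ, c ≠ 0 → {i // u i = c} ≃ {j // v j = c} :=
    fun c hc => Fintype.equivOfCardEq (h c hc)
  refine ⟨fun i j => ∃ (c : ℝ) (hc : c ≠ 0) (hi : u i = c), (E c hc ⟨i, hi⟩ : m) = j,
    ?_, ?_, ?_, ?_, ?_⟩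
  · rintro i _ ⟨c, hc, hi, rfl⟩
    rw [hi, (E c hc ⟨i, hi⟩).2]
  · rintro i i' j ⟨c, hc, hi, hj⟩ ⟨c', hc', hi', hj'⟩
    have e : c = c' := by
      rw [← (E c hc ⟨i, hi⟩).2, hj, ← hj', (E c' hc' ⟨i', hi'⟩).2]
    subst e
    simpa using (E c hc).injective (Subtype.ext (hj.trans hj'.symm))
  · rintro i j j' ⟨c, hc, hi, rfl⟩ ⟨c', hc', hi', rfl⟩
    subst hi
    subst hi'
    rfl
  · exact fun i hi => ⟨_, _, hi, rfl, rfl⟩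
  · exact fun j hj => ⟨(E _ hj).symm ⟨j, rfl⟩, _, hj, ((E _ hj).symm ⟨j, rfl⟩).2, by simp⟩

open Classical in
/-- The matrix with entry `√(u i)` at every related pair `(i, j)`, and zero elsewhere. -/
def matchingMatrix {n m : Type*} (u : n → ℝ) (R : n → m → Prop) : Matrix n m ℂ :=
  fun i j => if R i j then (Real.sqrt (u i) : ℂ) else 0

theorem NonzeroMatching.conjTranspose_matchingMatrix {n m : Type*} {u : n → ℝ} {v : m → ℝ}
    {R : n → m → Prop} (h : NonzeroMatching u v R) :
    (matchingMatrix u R)ᴴ = matchingMatrix v (fun j i => R i j) := by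
  ext j i
  by_cases r : R i j
  · simp [matchingMatrix, r, h.eq r]
  · simp [matchingMatrix, r]

theorem NonzeroMatching.matchingMatrix_mul_conjTranspose {n m : Type*} [DecidableEq n]
    [Fintype m] {u : n → ℝ} {v : m → ℝ} {R : n → m → Prop} (h : NonzeroMatching u v R)
    (hu : ∀ i, 0 ≤ u i) :
    matchingMatrix u R * (matchingMatrix u R)ᴴ = diagonal (fun i => (u i : ℂ)) := by
  ext i i'
  rw [mul_apply]
  by_cases hi : ∃ j, R i j
  · obtain ⟨j, hj⟩ := hi
    rw [Finset.sum_eq_single j]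
    · by_cases e : i = i'
      · subst e
        simp [matchingMatrix, hj, ← Complex.ofReal_mul, Real.mul_self_sqrt (hu i)]
      · have : ¬ R i' j := fun r => e (h.left_unique hj r)
        simp [matchingMatrix, this, e]
    · intro j' _ hne
      have : ¬ R i j' := fun r => hne (h.right_unique r hj)
      simp [matchingMatrix, this]
    · simp
  · have h0 : u i = 0 := by
      by_contra h0
      exact hi (h.left_total i h0)
    push Not at hi
    rw [Finset.sum_eq_zero (fun j _ => by simp [matchingMatrix, hi j])]
    by_cases e : i = i'
    · subst e
      simp [h0]
    · simp [e]

theorem NonzeroMatching.conjTranspose_mul_matchingMatrix {n m : Type*} [DecidableEq m]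
    [Fintype n] {u : n → ℝ} {v : m → ℝ} {R : n → m → Prop} (h : NonzeroMatching u v R)
    (hv : ∀ j, 0 ≤ v j) :
    (matchingMatrix u R)ᴴ * matchingMatrix u R = diagonal (fun j => (v j : ℂ)) := by
  have := h.symm.matchingMatrix_mul_conjTranspose hv
  rwa [← h.conjTranspose_matchingMatrix, conjTranspose_conjTranspose] at this

theorem nonzeroSpec_eq_iff_exists_mul_conjTranspose {n m : Type*} [Fintype n] [DecidableEq n]
    [Fintype m] [DecidableEq m] {ρ : Matrix n n ℂ} {τ : Matrix m m ℂ} (hρ : ρ.PosSemidef)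
    (hτ : τ.PosSemidef) :
    nonzeroSpec ρ = nonzeroSpec τ ↔ ∃ M : Matrix n m ℂ, M * Mᴴ = ρ ∧ Mᴴ * M = τ := by
  constructor
  · intro h
    obtain ⟨R, hR⟩ := exists_nonzeroMatching hρ.isHermitian.eigenvalues hτ.isHermitian.eigenvalues
      fun c hc => by
        rw [card_eigenvalues_eq_count_nonzeroSpec _ hc, card_eigenvalues_eq_count_nonzeroSpec _ hc,
          h]
    have hD := hR.matchingMatrix_mul_conjTranspose hρ.eigenvalues_nonneg
    have hD' := hR.conjTranspose_mul_matchingMatrix hτ.eigenvalues_nonneg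
    have hρs := hρ.isHermitian.spectral_theorem
    have hτs := hτ.isHermitian.spectral_theorem
    set D := matchingMatrix hρ.isHermitian.eigenvalues R
    rw [Unitary.conjStarAlgAut_apply] at hρs hτs
    have hU := Unitary.coe_star_mul_self hρ.isHermitian.eigenvectorUnitary
    have hV := Unitary.coe_star_mul_self hτ.isHermitian.eigenvectorUnitary
    set U : Matrix n n ℂ := ↑hρ.isHermitian.eigenvectorUnitary
    set V : Matrix m m ℂ := ↑hτ.isHermitian.eigenvectorUnitary
    rw [star_eq_conjTranspose] at hU hV hρs hτs
    refine ⟨U * D * Vᴴ, ?_, ?_⟩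
    · rw [hρs]
      calc U * D * Vᴴ * (U * D * Vᴴ)ᴴ = U * D * (Vᴴ * V) * Dᴴ * Uᴴ := by
            simp [Matrix.mul_assoc]
        _ = U * (D * Dᴴ) * Uᴴ := by rw [hV]; simp [Matrix.mul_assoc]
        _ = _ := by rw [hD]; rfl
    · rw [hτs]
      calc (U * D * Vᴴ)ᴴ * (U * D * Vᴴ) = V * Dᴴ * (Uᴴ * U) * D * Vᴴ := by
            simp [Matrix.mul_assoc]
        _ = V * (Dᴴ * D) * Vᴴ := by rw [hU]; simp [Matrix.mul_assoc]
        _ = _ := by rw [hD']; rfl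
  · rintro ⟨M, rfl, rfl⟩
    exact nonzeroSpec_mul_comm M Mᴴ

theorem posSemidef_reduceB {A B : Type*} [Fintype A] [Fintype B]
    {ρ : Matrix (A × B) (A × B) ℂ} (hρ : ρ.PosSemidef) : (reduceB ρ).PosSemidef := by
  have : reduceB ρ = ∑ a, ρ.submatrix (fun b => (a, b)) (fun b => (a, b)) := by
    ext b b'
    simp [reduceB, Matrix.sum_apply]
  rw [this]
  exact posSemidef_sum _ fun a _ => hρ.submatrix _

/-- The spectrum condition holds iff there is a purification `ψ` of `ρ` on `A ⊗ B ⊗ B'`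
whose reduced states on the `B` and `B'` factors coincide. -/
theorem stmt_5 (dA dB : ℕ)
    (ρ : Matrix (Fin dA × Fin dB) (Fin dA × Fin dB) ℂ)
    (hρ : ρ.PosSemidef) (hρtr : ρ.trace = 1) :
    nonzeroSpec ρ = nonzeroSpec (reduceB ρ) ↔
    ∃ ψ : (Fin dA × Fin dB × Fin dB) → ℂ,
      dotProduct (star ψ) ψ = 1 ∧
      (∀ a a' b b',
        ∑ c, vecMulVec ψ (star ψ) (a, b, c) (a', b', c) = ρ (a, b) (a', b')) ∧
      (∀ b b',
        ∑ a, ∑ c, vecMulVec ψ (star ψ) (a, b, c) (a, b', c) =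
        ∑ a, ∑ c, vecMulVec ψ (star ψ) (a, c, b) (a, c, b')) := by
  rw [← nonzeroSpec_transpose (reduceB ρ),
    nonzeroSpec_eq_iff_exists_mul_conjTranspose hρ (posSemidef_reduceB hρ).transpose]
  constructor
  · rintro ⟨M, hM, hM'⟩
    have hM₁ : ∀ a a' b b', ∑ c, M (a, b) c * star (M (a', b') c) = ρ (a, b) (a', b') := by
      intro a a' b b'
      simp [← hM, mul_apply]
    refine ⟨fun x => M (x.1, x.2.1) x.2.2, ?_, ?_, ?_⟩
    · rw [← hρtr, trace, dotProduct]
      simp only [Fintype.sum_prod_type, diag_apply, ← hM₁, Pi.star_apply, mul_comm]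
    · simpa [vecMulVec_apply] using hM₁
    · intro b b'
      have h := congrFun (congrFun hM' b') b
      rw [mul_apply, Fintype.sum_prod_type, transpose_apply, reduceB] at h
      simp only [vecMulVec_apply, Pi.star_apply, hM₁, ← h, conjTranspose_apply, mul_comm]
  · rintro ⟨ψ, -, h₁, h₂⟩
    refine ⟨of fun x c => ψ (x.1, x.2, c), ?_, ?_⟩
    · ext ⟨a, b⟩ ⟨a', b'⟩
      simp [← h₁, mul_apply, vecMulVec_apply]
    · ext b' b
      have h := h₂ b b'
      simp only [h₁] at h
      rw [mul_apply, Fintype.sum_prod_type, transpose_apply, reduceB, h]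
      simp only [vecMulVec_apply, Pi.star_apply, conjTranspose_apply, of_apply, mul_comm]
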